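/- arXiv:2403.10445 — 2 statements merged into one kernel-verified Lean document; each statement's English description precedes it below -/
import Mathlib

section
/- Let (X,d) be a metric space, μ a Borel measure on X that is finite on bounded sets and satisfies μ(X \ supp μ) = 0, and let t > 1, s > 0. Suppose M is a positive integer such that for every x ∈ X, every strict s-net contained in the closed ball B(x, t·s) has cardinality at most M. Then a_{t,s,μ}(y) ≤ M for every y ∈ supp μ. -/
open MeasureTheory Metric Bornology ENNReal

/-- The support of a Borel measure: points all of whose open balls have positive measure. -/
def measSupport {X : Type*} [MetricSpace X] [MeasurableSpace X]
    (μ : Measure X) : Set X :=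
  {x : X | ∀ r > 0, 0 < μ (Metric.ball x r)}

/-- The conjugate function `a_{t,s,μ}(y) = ∫_X 1_{B(y,ts)}(x) / μ(B(x,s)) dμ(x)`. -/
noncomputable def conjFn {X : Type*} [MetricSpace X] [MeasurableSpace X]
    (μ : Measure X) (t s : ℝ) (y : X) : ℝ≥0∞ :=
  ∫⁻ x in Metric.closedBall y (t * s), (μ (Metric.closedBall x s))⁻¹ ∂μ

/-- A greedy covering bound: if strict `s`-nets in `A` have at most `k` points, then the integral
over `A` of the inverse of the measure of closed `s`-balls is at most `k`, up to any factor
`c > 1`. -/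
theorem setLIntegral_inv_measure_closedBall_le {X : Type*} [MetricSpace X] [MeasurableSpace X]
    (μ : Measure X) {s : ℝ} (hs : 0 ≤ s) {c δ : ℝ≥0∞} (hc : 1 < c) (hδ : δ ≠ 0)
    (htop : ∀ x, μ (closedBall x s) ≠ ⊤) (k : ℕ) (A : Set X)
    (hA : ∀ x ∈ A, δ ≤ μ (closedBall x s))
    (hnet : ∀ S : Finset X, (↑S : Set X) ⊆ A →
      (∀ u ∈ S, ∀ v ∈ S, u ≠ v → s < dist u v) → S.card ≤ k) :
    ∫⁻ x in A, (μ (closedBall x s))⁻¹ ∂μ ≤ k * c := by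
  classical
  induction k generalizing A with
  | zero =>
    have hempty : A = ∅ := by
      refine Set.eq_empty_of_forall_notMem fun x hx => ?_
      have := hnet {x} (by simpa using hx) (by simp)
      simp at this
    simp [hempty]
  | succ k ih =>
    rcases A.eq_empty_or_nonempty with rfl | ⟨x₀, hx₀⟩
    · simp
    set m : ℝ≥0∞ := ⨅ x ∈ A, μ (closedBall x s) with hm
    have hm0 : m ≠ 0 := (lt_of_lt_of_le (pos_iff_ne_zero.2 hδ) (le_iInf₂ hA)).ne'
    have hmtop : m ≠ ⊤ := ne_top_of_le_ne_top (htop x₀) (iInf₂_le x₀ hx₀)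
    have hlt : m < c * m := by
      simpa using ENNReal.mul_lt_mul_left hm0 hmtop hc
    obtain ⟨v, hv, hvm⟩ : ∃ v ∈ A, μ (closedBall v s) < c * m := by
      simpa only [hm, iInf_lt_iff, exists_prop] using hlt
    have hfar : ∫⁻ x in A \ closedBall v s, (μ (closedBall x s))⁻¹ ∂μ ≤ k * c := by
      refine ih _ (fun x hx => hA x hx.1) fun S hS hsep => ?_
      have hvS : ∀ u ∈ S, s < dist u v := fun u hu => by
        simpa using (hS hu).2
      have hnot : v ∉ S := fun h => (hvS v h).not_ge (by simpa using hs)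
      have hcard := hnet (insert v S)
        (by
          rw [Finset.coe_insert]
          exact Set.insert_subset hv fun u hu => (hS hu).1)
        (by
          intro u hu w hw huw
          rcases Finset.mem_insert.1 hu with rfl | huS <;>
            rcases Finset.mem_insert.1 hw with rfl | hwS
          · exact absurd rfl huw
          · rw [dist_comm]; exact hvS w hwS
          · exact hvS u huS
          · exact hsep u huS w hwS huw)
      rw [Finset.card_insert_of_notMem hnot] at hcard
      omega
    have hnear : ∫⁻ x in A ∩ closedBall v s, (μ (closedBall x s))⁻¹ ∂μ ≤ c := by
      calc ∫⁻ x in A ∩ closedBall v s, (μ (closedBall x s))⁻¹ ∂μ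
          ≤ ∫⁻ _ in A ∩ closedBall v s, m⁻¹ ∂μ :=
            setLIntegral_mono measurable_const fun x hx =>
              ENNReal.inv_le_inv.2 (iInf₂_le x hx.1)
        _ = m⁻¹ * μ (A ∩ closedBall v s) := setLIntegral_const _ _
        _ ≤ m⁻¹ * (c * m) := by
            gcongr
            exact (measure_mono Set.inter_subset_right).trans hvm.le
        _ = c := by
            rw [mul_comm c, ← mul_assoc, ENNReal.inv_mul_cancel hm0 hmtop, one_mul]
    calc ∫⁻ x in A, (μ (closedBall x s))⁻¹ ∂μ
        = ∫⁻ x in A ∩ closedBall v s ∪ A \ closedBall v s, (μ (closedBall x s))⁻¹ ∂μ := by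
          rw [Set.inter_union_sdiff]
      _ ≤ c + k * c := (lintegral_union_le _ _ _).trans (add_le_add hnear hfar)
      _ = (k + 1 : ℕ) * c := by push_cast; ring

theorem stmt8 {X : Type*} [MetricSpace X] [MeasurableSpace X] [BorelSpace X]
    (μ : Measure X)
    (hbdd : ∀ s : Set X, IsBounded s → μ s < ⊤)
    (hsupp : μ (measSupport μ)ᶜ = 0)
    (t s : ℝ) (ht : 1 < t) (hs : 0 < s)
    (M : ℕ) (hM : 0 < M)
    (hnet : ∀ x : X, ∀ S : Finset X,
      (↑S : Set X) ⊆ Metric.closedBall x (t * s) →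
      (∀ u ∈ S, ∀ v ∈ S, u ≠ v → s < dist u v) →
      S.card ≤ M) :
    ∀ y ∈ measSupport μ, conjFn μ t s y ≤ (M : ℝ≥0∞) := by
  intro y _
  have hM0 : (M : ℝ≥0∞) ≠ 0 := by exact_mod_cast hM.ne'
  have htrunc : ∀ n : ℕ, ∫⁻ x in closedBall y (t * s) ∩
      {x | ((n : ℝ≥0∞))⁻¹ ≤ μ (closedBall x s)}, (μ (closedBall x s))⁻¹ ∂μ ≤ M := by
    intro n
    have h : ∀ c : ℝ≥0∞, 1 < c → ∫⁻ x in closedBall y (t * s) ∩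
        {x | ((n : ℝ≥0∞))⁻¹ ≤ μ (closedBall x s)}, (μ (closedBall x s))⁻¹ ∂μ ≤ M * c :=
      fun c hc => setLIntegral_inv_measure_closedBall_le μ hs.le hc
        (ENNReal.inv_ne_zero.2 (ENNReal.natCast_ne_top n))
        (fun x => (hbdd _ isBounded_closedBall).ne) M _ (fun x hx => hx.2)
        fun S hS => hnet y S (hS.trans Set.inter_subset_left)
    have hdiv := le_of_forall_gt_imp_ge_of_dense fun c hc =>
      ENNReal.div_le_of_le_mul' (h c hc)
    simpa using (ENNReal.div_le_iff hM0 (ENNReal.natCast_ne_top M)).1 hdiv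
  have hmono : Monotone fun n : ℕ => closedBall y (t * s) ∩
      {x | ((n : ℝ≥0∞))⁻¹ ≤ μ (closedBall x s)} := fun i j hij x hx =>
    ⟨hx.1, le_trans (ENNReal.inv_le_inv.2 (by exact_mod_cast hij)) hx.2⟩
  have hcover : closedBall y (t * s) ⊆ (⋃ n : ℕ, closedBall y (t * s) ∩
      {x | ((n : ℝ≥0∞))⁻¹ ≤ μ (closedBall x s)}) ∪ (measSupport μ)ᶜ := by
    intro x hx
    by_cases hxs : x ∈ measSupport μ
    · have hpos : μ (closedBall x s) ≠ 0 :=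
        ((hxs s hs).trans_le (measure_mono ball_subset_closedBall)).ne'
      obtain ⟨n, hn⟩ := ENNReal.exists_inv_nat_lt hpos
      exact Or.inl (Set.mem_iUnion.2 ⟨n, hx, hn.le⟩)
    · exact Or.inr hxs
  calc conjFn μ t s y
      ≤ _ := lintegral_mono_set hcover
    _ ≤ _ := lintegral_union_le _ _ _
    _ ≤ M + 0 := by
        gcongr
        · rw [setLIntegral_iUnion_of_directed _ hmono.directed_le]
          exact iSup_le htrunc
        · exact (setLIntegral_measure_zero _ _ hsupp).le
    _ = M := add_zero _
end

section
/- Let (X,d) be a metric space that is geometrically doubling with constant D (for closed balls). Then for every Borel measure μ on X that is finite on bounded sets and satisfies μ(X \ supp μ) = 0, every t > 1 and every s > 0, the superaveraging operator A_{t,s,μ} satisfies ‖A_{t,s,μ} f‖_{L¹(μ)} ≤ D^⌈log₂(2t)⌉ · ‖f‖_{L¹(μ)} for every f ∈ L¹(μ), where ⌈·⌉ denotes the ceiling function. -/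
open MeasureTheory Metric Bornology ENNReal

/-- The modified averaging operator
`A_{t,s,μ} f (x) = (1/μ(B(x,s))) ∫_{B(x,ts)} f dμ` (real-valued). -/
noncomputable def avgOp {X : Type*} [MetricSpace X] [MeasurableSpace X]
    (μ : Measure X) (t s : ℝ) (f : X → ℝ) (x : X) : ℝ :=
  (∫ y in Metric.closedBall x (t * s), f y ∂μ) /
    (μ (Metric.closedBall x s)).toReal

/-- Iterating the doubling condition `n` times covers a closed ball by `D ^ n` closed balls whose
radius is smaller by the factor `2 ^ n`. -/
theorem exists_finset_cover_closedBall_pow {X : Type*} [MetricSpace X] (D : ℕ)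
    (hdoub : ∀ (x : X) (r : ℝ), 0 < r → ∃ s : Finset X, s.card ≤ D ∧
      Metric.closedBall x r ⊆ ⋃ y ∈ s, Metric.closedBall y (r / 2))
    (n : ℕ) (x : X) {r : ℝ} (hr : 0 < r) :
    ∃ s : Finset X, s.card ≤ D ^ n ∧
      Metric.closedBall x r ⊆ ⋃ y ∈ s, Metric.closedBall y (r / 2 ^ n) := by
  classical
  induction n with
  | zero => exact ⟨{x}, by simp⟩
  | succ n ih =>
    obtain ⟨s, hs, hcov⟩ := ih
    choose T hT hTcov using fun y : X => hdoub y (r / 2 ^ n) (by positivity)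
    refine ⟨s.biUnion T, ?_, fun z hz => ?_⟩
    · calc (s.biUnion T).card ≤ s.card * D := Finset.card_biUnion_le_card_mul _ _ _ fun y _ => hT y
        _ ≤ D ^ (n + 1) := by rw [pow_succ]; gcongr
    · obtain ⟨y, hy, hzy⟩ := Set.mem_iUnion₂.1 (hcov hz)
      obtain ⟨w, hw, hzw⟩ := Set.mem_iUnion₂.1 (hTcov y hzy)
      refine Set.mem_iUnion₂.2 ⟨w, Finset.mem_biUnion.2 ⟨y, hy, hw⟩, ?_⟩
      rwa [pow_succ, ← div_div]

/-- A geometrically doubling metric space is second countable. -/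
theorem secondCountableTopology_of_doubling {X : Type*} [MetricSpace X] (D : ℕ)
    (hdoub : ∀ (x : X) (r : ℝ), 0 < r → ∃ s : Finset X, s.card ≤ D ∧
      Metric.closedBall x r ⊆ ⋃ y ∈ s, Metric.closedBall y (r / 2)) :
    SecondCountableTopology X := by
  refine Metric.secondCountable_of_almost_dense_set fun ε hε => ?_
  rcases isEmpty_or_nonempty X with hX | ⟨⟨a⟩⟩
  · exact ⟨∅, Set.countable_empty, fun x => hX.elim x⟩
  choose T _ hT using fun p : ℕ × ℕ => exists_finset_cover_closedBall_pow D hdoub p.1 a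
    (r := (p.2 : ℝ) + 1) (by positivity)
  refine ⟨⋃ p, (T p : Set X), Set.countable_iUnion fun p => (T p).countable_toSet, fun x => ?_⟩
  obtain ⟨k, hk⟩ := exists_nat_ge (dist x a)
  obtain ⟨n, hn⟩ := pow_unbounded_of_one_lt (((k : ℝ) + 1) / ε) one_lt_two
  have hx : x ∈ Metric.closedBall a ((k : ℝ) + 1) := by
    rw [Metric.mem_closedBall]; linarith
  obtain ⟨y, hy, hxy⟩ := Set.mem_iUnion₂.1 (hT (n, k) hx)
  refine ⟨y, Set.mem_iUnion.2 ⟨(n, k), hy⟩, (Metric.mem_closedBall.1 hxy).trans ?_⟩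
  rw [div_le_iff₀ (by positivity)]
  rw [div_lt_iff₀ hε] at hn
  linarith

/-- On a ball of radius at most `s / 2`, the function `x ↦ 1 / μ (B(x, s))` has integral at most
one. -/
theorem setLIntegral_inv_measure_closedBall_le_one {X : Type*} [MetricSpace X]
    [MeasurableSpace X] [BorelSpace X] (μ : Measure X) (z : X) {ρ s : ℝ} (h : ρ ≤ s / 2) :
    ∫⁻ x in Metric.closedBall z ρ, (μ (Metric.closedBall x s))⁻¹ ∂μ ≤ 1 := by
  calc ∫⁻ x in Metric.closedBall z ρ, (μ (Metric.closedBall x s))⁻¹ ∂μ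
      ≤ ∫⁻ _ in Metric.closedBall z ρ, (μ (Metric.closedBall z ρ))⁻¹ ∂μ := by
        refine setLIntegral_mono measurable_const fun x hx => ?_
        refine ENNReal.inv_le_inv.2 (measure_mono (Metric.closedBall_subset_closedBall' ?_))
        rw [Metric.mem_closedBall, dist_comm] at hx
        linarith
    _ ≤ 1 := by
        rw [setLIntegral_const, mul_comm]
        exact ENNReal.mul_inv_le_one _

theorem setLIntegral_inv_measure_closedBall_le_pow {X : Type*} [MetricSpace X]
    [MeasurableSpace X] [BorelSpace X] (D : ℕ)
    (hdoub : ∀ (x : X) (r : ℝ), 0 < r → ∃ s : Finset X, s.card ≤ D ∧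
      Metric.closedBall x r ⊆ ⋃ y ∈ s, Metric.closedBall y (r / 2))
    (μ : Measure X) (y : X) {r s : ℝ} (hr : 0 < r) {n : ℕ} (h : r / 2 ^ n ≤ s / 2) :
    ∫⁻ x in Metric.closedBall y r, (μ (Metric.closedBall x s))⁻¹ ∂μ ≤ (D : ℝ≥0∞) ^ n := by
  obtain ⟨T, hT, hcov⟩ := exists_finset_cover_closedBall_pow D hdoub n y hr
  calc ∫⁻ x in Metric.closedBall y r, (μ (Metric.closedBall x s))⁻¹ ∂μ
      ≤ ∫⁻ x in ⋃ z ∈ T, Metric.closedBall z (r / 2 ^ n), (μ (Metric.closedBall x s))⁻¹ ∂μ :=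
        lintegral_mono_set hcov
    _ ≤ ∑ z ∈ T, ∫⁻ x in Metric.closedBall z (r / 2 ^ n), (μ (Metric.closedBall x s))⁻¹ ∂μ := by
        rw [← lintegral_finsetSum_measure]
        refine lintegral_mono' (Measure.le_iff.2 fun A hA => ?_) le_rfl
        rw [Measure.restrict_apply hA, Set.inter_iUnion₂, Measure.finsetSum_apply]
        refine (measure_biUnion_finset_le _ _).trans (le_of_eq ?_)
        exact Finset.sum_congr rfl fun z _ => (Measure.restrict_apply hA).symm
    _ ≤ ∑ _z ∈ T, 1 :=
        Finset.sum_le_sum fun z _ => setLIntegral_inv_measure_closedBall_le_one μ z h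
    _ ≤ (D : ℝ≥0∞) ^ n := by
        rw [Finset.sum_const, nsmul_one]
        exact_mod_cast hT

theorem enorm_avgOp_le {X : Type*} [MetricSpace X] [MeasurableSpace X] (μ : Measure X)
    (t s : ℝ) (f : X → ℝ) (x : X) (hfin : μ (Metric.closedBall x s) ≠ ⊤) :
    ‖avgOp μ t s f x‖ₑ ≤
      (∫⁻ y in Metric.closedBall x (t * s), ‖f y‖ₑ ∂μ) * (μ (Metric.closedBall x s))⁻¹ := by
  rw [avgOp]
  rcases eq_or_ne (μ (Metric.closedBall x s)) 0 with h0 | h0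
  · simp [h0]
  · have hpos : 0 < (μ (Metric.closedBall x s)).toReal := ENNReal.toReal_pos h0 hfin
    rw [div_eq_mul_inv, enorm_mul, enorm_inv hpos.ne', Real.enorm_of_nonneg hpos.le,
      ENNReal.ofReal_toReal hfin]
    gcongr
    exact enorm_integral_le_lintegral_enorm _

theorem stmt9 {X : Type*} [MetricSpace X] [MeasurableSpace X] [BorelSpace X]
    (D : ℕ) (hD : 0 < D)
    (hdoub : ∀ (x : X) (r : ℝ), 0 < r → ∃ s : Finset X, s.card ≤ D ∧
      Metric.closedBall x r ⊆ ⋃ y ∈ s, Metric.closedBall y (r / 2)) :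
    ∀ μ : Measure X,
      (∀ s : Set X, IsBounded s → μ s < ⊤) →
      μ (measSupport μ)ᶜ = 0 →
      ∀ t : ℝ, 1 < t → ∀ s : ℝ, 0 < s →
        ∀ f : X → ℝ, Integrable f μ →
          eLpNorm (avgOp μ t s f) 1 μ
            ≤ (D : ℝ≥0∞) ^ ⌈Real.logb 2 (2 * t)⌉₊ * eLpNorm f 1 μ := by
  intro μ hμ _ t ht s hs f hf
  have : SecondCountableTopology X := secondCountableTopology_of_doubling D hdoub
  have : IsLocallyFiniteMeasure μ :=
    ⟨fun x => ⟨Metric.ball x 1, Metric.ball_mem_nhds x one_pos, hμ _ Metric.isBounded_ball⟩⟩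
  set n := ⌈Real.logb 2 (2 * t)⌉₊ with hn
  have hscale : t * s / 2 ^ n ≤ s / 2 := by
    have h2t : 2 * t ≤ 2 ^ n := by
      rw [← Real.rpow_natCast, ← Real.logb_le_iff_le_rpow one_lt_two (by linarith)]
      exact Nat.le_ceil _
    rw [div_le_div_iff₀ (by positivity) two_pos]
    nlinarith
  have hclosed (r : ℝ) : MeasurableSet {p : X × X | dist p.2 p.1 ≤ r} :=
    (isClosed_le (by fun_prop) continuous_const).measurableSet
  have hball : Measurable fun x => (μ (Metric.closedBall x s))⁻¹ :=
    (measurable_measure_prodMk_left (ν := μ) (hclosed s)).inv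
  have hmeas : AEMeasurable (fun p : X × X =>
      {p : X × X | dist p.2 p.1 ≤ t * s}.indicator
        (fun p => ‖f p.2‖ₑ * (μ (Metric.closedBall p.1 s))⁻¹) p) (μ.prod μ) :=
    ((hf.aestronglyMeasurable.enorm.comp_snd).mul
      (hball.comp measurable_fst).aemeasurable).indicator (hclosed _)
  rw [eLpNorm_one_eq_lintegral_enorm, eLpNorm_one_eq_lintegral_enorm]
  calc ∫⁻ x, ‖avgOp μ t s f x‖ₑ ∂μ
      ≤ ∫⁻ x, ∫⁻ y, {p : X × X | dist p.2 p.1 ≤ t * s}.indicator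
          (fun p => ‖f p.2‖ₑ * (μ (Metric.closedBall p.1 s))⁻¹) (x, y) ∂μ ∂μ := by
        refine lintegral_mono fun x => ?_
        refine (enorm_avgOp_le μ t s f x (hμ _ Metric.isBounded_closedBall).ne).trans (le_of_eq ?_)
        rw [← lintegral_mul_const'' _ hf.aestronglyMeasurable.enorm.restrict,
          ← lintegral_indicator Metric.isClosed_closedBall.measurableSet]
        rfl
    _ = ∫⁻ y, ∫⁻ x, {p : X × X | dist p.2 p.1 ≤ t * s}.indicator
          (fun p => ‖f p.2‖ₑ * (μ (Metric.closedBall p.1 s))⁻¹) (x, y) ∂μ ∂μ :=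
        lintegral_lintegral_swap hmeas
    _ = ∫⁻ y, ‖f y‖ₑ *
          ∫⁻ x in Metric.closedBall y (t * s), (μ (Metric.closedBall x s))⁻¹ ∂μ ∂μ := by
        refine lintegral_congr fun y => ?_
        rw [← lintegral_const_mul _ hball,
          ← lintegral_indicator Metric.isClosed_closedBall.measurableSet]
        refine lintegral_congr fun x => ?_
        simp only [Set.indicator, Set.mem_ofPred_eq, Metric.mem_closedBall, dist_comm]
    _ ≤ ∫⁻ y, ‖f y‖ₑ * (D : ℝ≥0∞) ^ n ∂μ := by
        gcongr with y
        exact setLIntegral_inv_measure_closedBall_le_pow D hdoub μ y (by positivity) hscale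
    _ = (D : ℝ≥0∞) ^ n * ∫⁻ y, ‖f y‖ₑ ∂μ := by
        rw [lintegral_mul_const'' _ hf.aestronglyMeasurable.enorm, mul_comm]
end
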